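/- arXiv:2503.14728 — 7 statements merged into one kernel-verified Lean document; each statement's English description precedes it below -/
import Mathlib

section
/- Let τ₀ > 0 and let w₀, w be real numbers with w ≠ w₀. Define ε : (0, ∞) → ℝ by ε(τ) = (τ + τ₀²·(w − w₀)²)/(τ₀ + τ)². If τ₀ ≥ 1/(2·(w − w₀)²), then ε is antitone (monotonically nonincreasing) on (0, ∞); that is, for all 0 < τ ≤ τ', ε(τ') ≤ ε(τ). -/
/-- In the regime `τ₀ ≥ 1 / (2 (w - w₀)^2)` (Situation 1), the expected retrieval error
`ε(τ) = (τ + τ₀^2 (w - w₀)^2) / (τ₀ + τ)^2` is antitone in the encoding precision on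
`(0, ∞)`: for all `0 < τ ≤ τ'`, `ε(τ') ≤ ε(τ)`. -/
theorem error_antitone_of_situation1 (τ₀ : ℝ) (hτ₀ : 0 < τ₀) (w₀ w : ℝ) (hw : w ≠ w₀)
    (hcond : τ₀ ≥ 1 / (2 * (w - w₀) ^ 2)) :
    ∀ τ τ' : ℝ, 0 < τ → τ ≤ τ' →
      (τ' + τ₀ ^ 2 * (w - w₀) ^ 2) / (τ₀ + τ') ^ 2 ≤
        (τ + τ₀ ^ 2 * (w - w₀) ^ 2) / (τ₀ + τ) ^ 2 := by
  intro τ τ' hτ hle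
  have hτ' : 0 < τ' := hτ.trans_le hle
  have hd : 0 < (w - w₀) ^ 2 := sq_pos_of_ne_zero (sub_ne_zero.mpr hw)
  have hc : 0 ≤ τ₀ ^ 2 * (w - w₀) ^ 2 - τ₀ / 2 := by
    rw [ge_iff_le, div_le_iff₀ (by positivity)] at hcond
    nlinarith
  rw [div_le_div_iff₀ (by positivity) (by positivity), ← sub_nonneg]
  have hdiff : 0 ≤ τ' - τ := sub_nonneg.mpr hle
  calc
    0 ≤ (τ' - τ) * (((τ₀ + τ') * τ + (τ₀ + τ) * τ') / 2 +
        (τ₀ ^ 2 * (w - w₀) ^ 2 - τ₀ / 2) * ((τ₀ + τ) + (τ₀ + τ'))) := by positivity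
    _ = _ := by ring
end

section
/- Let τ₀ > 0 and define E : ℝ × (0, ∞) → ℝ by E(h, τ) = (τ + 2·τ₀·h + τ₀·ln(τ₀/(2π)))/(τ₀ + τ)². Let h₁ > h₂ and let 0 < τ₁ < τ₂ be encoding precisions. Then swapping the allocation strictly reduces the total expected error: E(h₁, τ₂) + E(h₂, τ₁) < E(h₁, τ₁) + E(h₂, τ₂). Equivalently, E(h₁, τ₁) + E(h₂, τ₂) − E(h₁, τ₂) − E(h₂, τ₁) = 2·τ₀·(h₁ − h₂)·(1/(τ₀ + τ₁)² − 1/(τ₀ + τ₂)²) > 0. -/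
/-- Exchange argument: for `E(h, τ) = (τ + 2 τ₀ h + τ₀ ln(τ₀/(2π)))/(τ₀+τ)^2`, surprisals
`h₁ > h₂` and precisions `0 < τ₁ < τ₂`, swapping the allocation strictly reduces the total
expected error: `E(h₁, τ₂) + E(h₂, τ₁) < E(h₁, τ₁) + E(h₂, τ₂)`; equivalently the
difference equals `2 τ₀ (h₁ - h₂) (1/(τ₀+τ₁)^2 - 1/(τ₀+τ₂)^2) > 0`. -/
theorem swap_reduces_error (τ₀ : ℝ) (hτ₀ : 0 < τ₀)
    (E : ℝ → ℝ → ℝ)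
    (hE : ∀ h τ, E h τ =
      (τ + 2 * τ₀ * h + τ₀ * Real.log (τ₀ / (2 * Real.pi))) / (τ₀ + τ) ^ 2)
    (h₁ h₂ : ℝ) (hh : h₁ > h₂) (τ₁ τ₂ : ℝ) (hτ₁ : 0 < τ₁) (hτ₁₂ : τ₁ < τ₂) :
    E h₁ τ₂ + E h₂ τ₁ < E h₁ τ₁ + E h₂ τ₂ ∧
    E h₁ τ₁ + E h₂ τ₂ - E h₁ τ₂ - E h₂ τ₁ =
      2 * τ₀ * (h₁ - h₂) * (1 / (τ₀ + τ₁) ^ 2 - 1 / (τ₀ + τ₂) ^ 2) ∧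
    0 < 2 * τ₀ * (h₁ - h₂) * (1 / (τ₀ + τ₁) ^ 2 - 1 / (τ₀ + τ₂) ^ 2) := by
  have hdiff : E h₁ τ₁ + E h₂ τ₂ - E h₁ τ₂ - E h₂ τ₁ =
      2 * τ₀ * (h₁ - h₂) * (1 / (τ₀ + τ₁) ^ 2 - 1 / (τ₀ + τ₂) ^ 2) := by
    simp only [hE]
    ring
  have hpos : 0 < 2 * τ₀ * (h₁ - h₂) * (1 / (τ₀ + τ₁) ^ 2 - 1 / (τ₀ + τ₂) ^ 2) := by
    have hinv : 1 / (τ₀ + τ₂) ^ 2 < 1 / (τ₀ + τ₁) ^ 2 :=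
      one_div_lt_one_div_of_lt (by positivity) (by gcongr)
    exact mul_pos (mul_pos (by positivity) (sub_pos.mpr hh)) (sub_pos.mpr hinv)
  exact ⟨by linarith, hdiff, hpos⟩
end

section
/- Strategic Resource Allocation (main Proposition): Let τ₀ > 0, let c > 0 be a total resource budget, and define E(h, τ) = (τ + 2·τ₀·h + τ₀·ln(τ₀/(2π)))/(τ₀ + τ)² for τ > 0. Let h₁ > h₂ be the surprisals of two inputs. If (τ₁, τ₂) with τ₁ > 0, τ₂ > 0 and τ₁ + τ₂ = c minimizes the total expected retrieval error E(h₁, τ₁) + E(h₂, τ₂) over all pairs of positive precisions summing to c, then τ₁ > τ₂; that is, the more surprising input must be encoded with strictly higher precision. -/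
/-- The derivative of a retrieval error curve `(t + a) / (s + t) ^ 2` in the precision `t`. -/
lemma hasDerivAt_add_div_add_sq (a s t : ℝ) (h : s + t ≠ 0) :
    HasDerivAt (fun x : ℝ => (x + a) / (s + x) ^ 2)
      (1 / (s + t) ^ 2 - 2 * (t + a) / (s + t) ^ 3) t := by
  have h1 : HasDerivAt (fun x : ℝ => x + a) 1 t := (hasDerivAt_id' t).add_const a
  have h2 : HasDerivAt (fun x : ℝ => (s + x) ^ 2) (2 * (s + t)) t := by
    simpa using ((hasDerivAt_id' t).const_add s).fun_pow 2
  refine (h1.div h2 (pow_ne_zero 2 h)).congr_deriv ?_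
  field_simp


/-- Strategic Resource Allocation (main Proposition): if `(τ₁, τ₂)` with positive
components summing to the budget `c` minimizes the total expected retrieval error
`E(h₁, τ₁) + E(h₂, τ₂)` over all pairs of positive precisions summing to `c`, and the
first input is more surprising (`h₁ > h₂`), then `τ₁ > τ₂`. -/
theorem strategic_resource_allocation (τ₀ c : ℝ) (hτ₀ : 0 < τ₀) (hc : 0 < c)
    (E : ℝ → ℝ → ℝ)
    (hE : ∀ h τ, E h τ =
      (τ + 2 * τ₀ * h + τ₀ * Real.log (τ₀ / (2 * Real.pi))) / (τ₀ + τ) ^ 2)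
    (h₁ h₂ : ℝ) (hh : h₁ > h₂)
    (τ₁ τ₂ : ℝ) (hτ₁ : 0 < τ₁) (hτ₂ : 0 < τ₂) (hsum : τ₁ + τ₂ = c)
    (hmin : ∀ τ₁' τ₂' : ℝ, 0 < τ₁' → 0 < τ₂' → τ₁' + τ₂' = c →
      E h₁ τ₁ + E h₂ τ₂ ≤ E h₁ τ₁' + E h₂ τ₂') :
    τ₁ > τ₂ := by
  obtain ⟨a, ha⟩ : ∃ a : ℝ → ℝ,
      ∀ h, a h = 2 * τ₀ * h + τ₀ * Real.log (τ₀ / (2 * Real.pi)) := ⟨_, fun _ => rfl⟩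
  have hE' : ∀ h τ, E h τ = (τ + a h) / (τ₀ + τ) ^ 2 := fun h τ => by rw [hE, ha, add_assoc]
  have ha_lt : a h₂ < a h₁ := by
    rw [ha, ha]
    gcongr
  by_contra! hle
  rcases hle.lt_or_eq with hlt | rfl
  · -- Swapping the two precisions lowers the total error.
    have hswap := hmin τ₂ τ₁ hτ₂ hτ₁ (by linarith)
    simp only [hE'] at hswap
    have hinv : 1 / (τ₀ + τ₂) ^ 2 < 1 / (τ₀ + τ₁) ^ 2 := by gcongr
    have hpos := mul_pos (sub_pos.2 ha_lt) (sub_pos.2 hinv)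
    simp only [div_eq_mul_one_div (_ + a _)] at hswap
    linarith
  · -- At equal precisions the first-order condition fails.
    have hs : τ₀ + τ₁ ≠ 0 := by positivity
    have hcτ : c - τ₁ = τ₁ := by linarith
    have hloc : IsLocalMin
        (fun t => (t + a h₁) / (τ₀ + t) ^ 2 + (c - t + a h₂) / (τ₀ + (c - t)) ^ 2) τ₁ := by
      filter_upwards [Ioo_mem_nhds hτ₁ (show τ₁ < c by linarith)] with t ht
      have := hmin t (c - t) ht.1 (sub_pos.2 ht.2) (by ring)
      simpa only [hE', hcτ] using this
    have hd₁ := hasDerivAt_add_div_add_sq (a h₁) τ₀ τ₁ hs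
    have hd₂ := (hasDerivAt_add_div_add_sq (a h₂) τ₀ (c - τ₁) (by rwa [hcτ])).comp_const_sub c τ₁
    have hzero := hloc.hasDerivAt_eq_zero (hd₁.add hd₂)
    rw [hcτ] at hzero
    field_simp at hzero
    linarith
end

section
/- Let τ₀ > 0, c > 0, and define E(h, τ) = (τ + 2·τ₀·h + τ₀·ln(τ₀/(2π)))/(τ₀ + τ)² for τ > 0. Let h₁ > h₂. Then for every pair (τ₁, τ₂) with τ₁ > 0, τ₂ > 0, τ₁ + τ₂ = c and τ₁ ≤ τ₂, there exists a pair (τ₁', τ₂') with τ₁' > 0, τ₂' > 0, τ₁' + τ₂' = c, and E(h₁, τ₁') + E(h₂, τ₂') < E(h₁, τ₁) + E(h₂, τ₂). In particular, no allocation giving the more surprising input weakly fewer resources is optimal; in particular the uniform allocation τ₁ = τ₂ = c/2 is never optimal. -/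
/-- The derivative of the expected error in the precision. -/
theorem hasDerivAt_expectedError {a b x : ℝ} (hx : a + x ≠ 0) :
    HasDerivAt (fun x : ℝ => (x + b) / (a + x) ^ 2) ((a - x - 2 * b) / (a + x) ^ 3) x := by
  have hnum : HasDerivAt (fun x : ℝ => x + b) 1 x := (hasDerivAt_id x).add_const b
  have hden : HasDerivAt (fun x : ℝ => (a + x) ^ 2) (2 * (a + x)) x := by
    simpa using ((hasDerivAt_id x).const_add a).fun_pow 2
  refine (hnum.fun_div hden (pow_ne_zero 2 hx)).congr_deriv ?_
  field_simp
  ring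

/-- Swapping two unequal precisions so that the larger offset gets the larger one
lowers the total error. -/
theorem expectedError_swap_lt {a b₁ b₂ x y : ℝ} (hx : 0 < a + x) (hxy : x < y) (hb : b₂ < b₁) :
    (y + b₁) / (a + y) ^ 2 + (x + b₂) / (a + x) ^ 2 <
      (x + b₁) / (a + x) ^ 2 + (y + b₂) / (a + y) ^ 2 := by
  have hsq : 1 / (a + y) ^ 2 < 1 / (a + x) ^ 2 := by gcongr
  have hprod := mul_pos (sub_pos.mpr hb) (sub_pos.mpr hsq)
  ring_nf at hprod ⊢
  linarith

/-- At equal precisions, shifting a little precision towards the larger offset lowers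
the total error. -/
theorem exists_expectedError_shift_lt {a b₁ b₂ x : ℝ} (ha : 0 < a) (hx : 0 < x) (hb : b₂ < b₁) :
    ∃ y z : ℝ, 0 < y ∧ 0 < z ∧ y + z = x + x ∧
      (y + b₁) / (a + y) ^ 2 + (z + b₂) / (a + z) ^ 2 <
        (x + b₁) / (a + x) ^ 2 + (x + b₂) / (a + x) ^ 2 := by
  by_contra! hmin
  have hne : a + x ≠ 0 := by positivity
  have hsub : x + x - x = x := by ring
  let F : ℝ → ℝ := fun y =>
    (y + b₁) / (a + y) ^ 2 + (x + x - y + b₂) / (a + (x + x - y)) ^ 2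
  have hF : IsLocalMin F x := by
    filter_upwards [Ioo_mem_nhds hx (by linarith : x < x + x)] with y hy
    simpa only [F, hsub] using
      hmin y (x + x - y) hy.1 (sub_pos.mpr hy.2) (by ring)
  have hd₂ := HasDerivAt.comp_const_sub (x + x) x
    (hasDerivAt_expectedError (a := a) (b := b₂) (x := x + x - x) (by rwa [hsub]))
  have hzero := hF.hasDerivAt_eq_zero ((hasDerivAt_expectedError (b := b₁) hne).add hd₂)
  rw [hsub] at hzero
  field_simp at hzero
  linarith


/-- No allocation giving the more surprising input weakly fewer resources is optimal:
if `h₁ > h₂` and `(τ₁, τ₂)` are positive precisions summing to `c` with `τ₁ ≤ τ₂`, then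
there exists a feasible pair `(τ₁', τ₂')` with strictly smaller total expected error.
In particular the uniform allocation `τ₁ = τ₂ = c/2` is never optimal. -/
theorem weakly_fewer_not_optimal (τ₀ c : ℝ) (hτ₀ : 0 < τ₀) (hc : 0 < c)
    (E : ℝ → ℝ → ℝ)
    (hE : ∀ h τ, E h τ =
      (τ + 2 * τ₀ * h + τ₀ * Real.log (τ₀ / (2 * Real.pi))) / (τ₀ + τ) ^ 2)
    (h₁ h₂ : ℝ) (hh : h₁ > h₂) :
    ∀ τ₁ τ₂ : ℝ, 0 < τ₁ → 0 < τ₂ → τ₁ + τ₂ = c → τ₁ ≤ τ₂ →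
      ∃ τ₁' τ₂' : ℝ, 0 < τ₁' ∧ 0 < τ₂' ∧ τ₁' + τ₂' = c ∧
        E h₁ τ₁' + E h₂ τ₂' < E h₁ τ₁ + E h₂ τ₂ := by
  intro τ₁ τ₂ hτ₁ hτ₂ hsum hle
  have hoffset : ∀ h τ, E h τ =
      (τ + (2 * τ₀ * h + τ₀ * Real.log (τ₀ / (2 * Real.pi)))) / (τ₀ + τ) ^ 2 := by
    intro h τ
    rw [hE, add_assoc]
  have hb : 2 * τ₀ * h₂ + τ₀ * Real.log (τ₀ / (2 * Real.pi)) <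
      2 * τ₀ * h₁ + τ₀ * Real.log (τ₀ / (2 * Real.pi)) := by gcongr
  simp only [hoffset]
  rcases hle.lt_or_eq with hlt | rfl
  · exact ⟨τ₂, τ₁, hτ₂, hτ₁, by linarith, expectedError_swap_lt (by linarith) hlt hb⟩
  · rw [← hsum]
    exact exists_expectedError_shift_lt hτ₀ hτ₁ hb
end

section
/- Let τ₀ > 0 and define E(h, τ) = (τ + 2·τ₀·h + τ₀·ln(τ₀/(2π)))/(τ₀ + τ)² for τ > 0. Fix c > 0 and h₁ > h₂, and define g : (−c/2, c/2) → ℝ by g(δ) = E(h₁, c/2 + δ) + E(h₂, c/2 − δ), the total error when the allocation is perturbed from uniform by shifting δ units of precision to the higher-surprisal input. Then g is differentiable at 0 with g'(0) = −4·τ₀·(h₁ − h₂)/(τ₀ + c/2)³ < 0. -/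
theorem hasDerivAt_add_const_div_sq (a k x : ℝ) (hx : a + x ≠ 0) :
    HasDerivAt (fun t : ℝ => (t + k) / (a + t) ^ 2) ((a - x - 2 * k) / (a + x) ^ 3) x := by
  have hnum : HasDerivAt (fun t : ℝ => t + k) 1 x := (hasDerivAt_id' x).add_const k
  have hden : HasDerivAt (fun t : ℝ => (a + t) ^ 2) (2 * (a + x)) x := by
    simpa using ((hasDerivAt_id' x).const_add a).fun_pow 2
  refine (hnum.fun_div hden (pow_ne_zero 2 hx)).congr_deriv ?_
  field_simp
  ring

/-- Perturbing from the uniform allocation towards the higher-surprisal input strictly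
decreases the total error to first order: with
`E(h, τ) = (τ + 2 τ₀ h + τ₀ ln(τ₀/(2π)))/(τ₀+τ)^2` and
`g(δ) = E(h₁, c/2 + δ) + E(h₂, c/2 - δ)`, `g` is differentiable at `0` with
`g'(0) = -4 τ₀ (h₁ - h₂) / (τ₀ + c/2)^3 < 0`. -/
theorem uniform_allocation_perturbation (τ₀ c : ℝ) (hτ₀ : 0 < τ₀) (hc : 0 < c)
    (E : ℝ → ℝ → ℝ)
    (hE : ∀ h τ, E h τ =
      (τ + 2 * τ₀ * h + τ₀ * Real.log (τ₀ / (2 * Real.pi))) / (τ₀ + τ) ^ 2)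
    (h₁ h₂ : ℝ) (hh : h₁ > h₂) :
    HasDerivAt (fun δ : ℝ => E h₁ (c / 2 + δ) + E h₂ (c / 2 - δ))
        (-(4 * τ₀ * (h₁ - h₂)) / (τ₀ + c / 2) ^ 3) 0 ∧
      -(4 * τ₀ * (h₁ - h₂)) / (τ₀ + c / 2) ^ 3 < 0 := by
  have hpos : 0 < τ₀ + c / 2 := by positivity
  have hE' (h : ℝ) : HasDerivAt (E h) ((τ₀ - c / 2 -
      2 * (2 * τ₀ * h + τ₀ * Real.log (τ₀ / (2 * Real.pi)))) / (τ₀ + c / 2) ^ 3) (c / 2) := by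
    rw [show E h = _ from funext (hE h)]
    simpa only [add_assoc] using hasDerivAt_add_const_div_sq τ₀ _ _ hpos.ne'
  constructor
  · have hadd := HasDerivAt.comp_const_add (c / 2) 0 (by simpa using hE' h₁)
    have hsub := HasDerivAt.comp_const_sub (c / 2) 0 (by simpa using hE' h₂)
    refine (hadd.fun_add hsub).congr_deriv ?_
    ring
  · have hdiff : 0 < h₁ - h₂ := sub_pos.mpr hh
    exact div_neg_of_neg_of_pos (neg_neg_of_pos (by positivity)) (by positivity)
end

section
/- Let τ₀ > 0 and let w₀, w be real numbers, and define ε : (0, ∞) → ℝ by ε(τ) = (τ + τ₀²·(w − w₀)²)/(τ₀ + τ)². If τ₀ < 1/(2·(w − w₀)²) (with w ≠ w₀), then setting τ* = τ₀ − 2·τ₀²·(w − w₀)², one has 0 < τ* and ε is strictly monotonically increasing on (0, τ*) and strictly monotonically decreasing on (τ*, ∞); that is, in the borderline regime where the input is close to the prior prediction and the prior is imprecise, the expected retrieval error as a function of encoding precision first rises and then falls, with its unique interior maximum at τ*. -/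
open Set

/-- The difference of two values of `u ↦ (u - c) / u ^ 2` has the sign of
`(v - u) * (c * (u + v) - u * v)`. -/
lemma sub_div_sq_sub_sub_div_sq {u v : ℝ} (hu : u ≠ 0) (hv : v ≠ 0) (c : ℝ) :
    (v - c) / v ^ 2 - (u - c) / u ^ 2 =
      (v - u) * (c * (u + v) - u * v) / (u ^ 2 * v ^ 2) := by
  field_simp
  ring

lemma strictMonoOn_sub_div_sq (c : ℝ) :
    StrictMonoOn (fun u : ℝ => (u - c) / u ^ 2) (Ioo 0 (2 * c)) := by
  rintro u ⟨hu, huc⟩ v ⟨hv, hvc⟩ huv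
  refine sub_pos.mp ?_
  rw [sub_div_sq_sub_sub_div_sq hu.ne' hv.ne']
  have : 0 < c * (u + v) - u * v := by
    linarith [mul_pos hu (sub_pos.2 hvc), mul_pos hv (sub_pos.2 huc)]
  have := sub_pos.2 huv
  positivity

lemma strictAntiOn_sub_div_sq {c : ℝ} (hc : 0 ≤ c) :
    StrictAntiOn (fun u : ℝ => (u - c) / u ^ 2) (Ioi (2 * c)) := by
  intro u huc v hvc huv
  rw [mem_Ioi] at huc hvc
  have hu : 0 < u := by linarith
  have hv : 0 < v := by linarith
  refine sub_neg.mp ?_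
  rw [sub_div_sq_sub_sub_div_sq hu.ne' hv.ne']
  have : c * (u + v) - u * v < 0 := by
    linarith [mul_pos hu (sub_pos.2 hvc), mul_pos hv (sub_pos.2 huc)]
  exact div_neg_of_neg_of_pos (mul_neg_of_pos_of_neg (sub_pos.2 huv) this) (by positivity)

/-- In the borderline regime `τ₀ < 1/(2 (w - w₀)^2)` (with `w ≠ w₀`), setting
`τ* = τ₀ - 2 τ₀^2 (w - w₀)^2`, the expected retrieval error
`ε(τ) = (τ + τ₀^2 (w - w₀)^2)/(τ₀ + τ)^2` satisfies `0 < τ*`, is strictly increasing on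
`(0, τ*)` and strictly decreasing on `(τ*, ∞)`. -/
theorem error_nonmonotonic_regime (τ₀ : ℝ) (hτ₀ : 0 < τ₀) (w₀ w : ℝ) (hw : w ≠ w₀)
    (hcond : τ₀ < 1 / (2 * (w - w₀) ^ 2))
    (τs : ℝ) (hτs : τs = τ₀ - 2 * τ₀ ^ 2 * (w - w₀) ^ 2) :
    0 < τs ∧
    StrictMonoOn (fun τ : ℝ => (τ + τ₀ ^ 2 * (w - w₀) ^ 2) / (τ₀ + τ) ^ 2) (Ioo 0 τs) ∧
    StrictAntiOn (fun τ : ℝ => (τ + τ₀ ^ 2 * (w - w₀) ^ 2) / (τ₀ + τ) ^ 2) (Ioi τs) := by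
  have hd : 0 < (w - w₀) ^ 2 := by
    have := sub_ne_zero.2 hw
    positivity
  rw [lt_div_iff₀ (by positivity)] at hcond
  have hs : 0 < τs := by
    rw [hτs]
    linarith [mul_pos hτ₀ (sub_pos.2 hcond)]
  have hshift : (fun τ : ℝ => (τ + τ₀ ^ 2 * (w - w₀) ^ 2) / (τ₀ + τ) ^ 2) =
      fun τ : ℝ => (τ₀ + τ - (τ₀ + τs) / 2) / (τ₀ + τ) ^ 2 := by
    funext τ
    rw [hτs]
    ring
  rw [hshift]
  refine ⟨hs, fun x hx y hy hxy => ?_, fun x hx y hy hxy => ?_⟩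
  · obtain ⟨hx₀, hxs⟩ := hx
    obtain ⟨hy₀, hys⟩ := hy
    exact strictMonoOn_sub_div_sq ((τ₀ + τs) / 2) ⟨by linarith, by linarith⟩
      ⟨by linarith, by linarith⟩ (by linarith : τ₀ + x < τ₀ + y)
  · rw [mem_Ioi] at hx hy
    exact strictAntiOn_sub_div_sq (by linarith : 0 ≤ (τ₀ + τs) / 2)
      (mem_Ioi.2 (by linarith)) (mem_Ioi.2 (by linarith)) (by linarith : τ₀ + x < τ₀ + y)
end

section
/- Let τ₀ > 0 and let w₀ be a real number. For w ≠ w₀, the condition τ₀ ≥ 1/(2·(w − w₀)²) holds if and only if τ₀ − τ − 2·τ₀²·(w − w₀)² ≤ 0 for all τ > 0; equivalently, the expected retrieval error ε(τ) = (τ + τ₀²(w − w₀)²)/(τ₀ + τ)² has nonpositive derivative at every τ > 0 exactly when τ₀·(w − w₀)² ≥ 1/2. -/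
/-- For `w ≠ w₀`, the Situation-1 condition `τ₀ ≥ 1/(2 (w - w₀)^2)` holds if and only if
the numerator of the derivative of the expected retrieval error,
`τ₀ - τ - 2 τ₀^2 (w - w₀)^2`, is nonpositive for every `τ > 0`. -/
theorem situation1_characterization (τ₀ : ℝ) (hτ₀ : 0 < τ₀) (w₀ w : ℝ) (hw : w ≠ w₀) :
    τ₀ ≥ 1 / (2 * (w - w₀) ^ 2) ↔
      ∀ τ : ℝ, 0 < τ → τ₀ - τ - 2 * τ₀ ^ 2 * (w - w₀) ^ 2 ≤ 0 := by
  have hd : 0 < (w - w₀) ^ 2 := by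
    have := sub_ne_zero.mpr hw
    positivity
  rw [ge_iff_le, div_le_iff₀ (by positivity)]
  constructor
  · intro h τ hτ
    nlinarith
  · intro h
    have hle : τ₀ ≤ 2 * τ₀ ^ 2 * (w - w₀) ^ 2 :=
      le_of_forall_pos_le_add fun τ hτ => by linarith [h τ hτ]
    refine le_of_mul_le_mul_left ?_ hτ₀
    linarith
end
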